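/- arXiv:2201.12196 — 2 statements merged into one kernel-verified Lean document; each statement's English description precedes it below -/
import Mathlib

section
/- Let μ be the self-similar measure of the IFS {S_a, S_b} with contraction ratio 1/R satisfying the strong separation condition, with probabilities p and q = 1 - p. Then the set of attainable local dimensions {dim_loc μ(x) : x ∈ supp μ, the limit exists} contains the closed interval [log(max(p,q))/log(1/R), log(min(p,q))/log(1/R)]. -/
open Set MeasureTheory Filter

namespace LocDim

/-- Greedy digit sequence, ordered case. -/
lemma greedy_aux (u v L : ℝ) (h1 : u ≤ L) (h2 : L ≤ v) :
    ∃ w : ℕ → Bool, ∃ D : ℝ, ∀ n : ℕ,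
      |∑ k ∈ Finset.range n, (if w k then u else v) - n * L| ≤ D := by
  classical
  let e : ℕ → ℝ := fun n => Nat.rec (motive := fun _ => ℝ) (0 : ℝ)
    (fun _ (e : ℝ) => e + ((if 0 < e then u else v) - L)) n
  have e0 : e 0 = 0 := rfl
  have es : ∀ n, e (n + 1) = e n + ((if 0 < e n then u else v) - L) := fun n => rfl
  refine ⟨fun n => decide (0 < e n), v - u, fun n => ?_⟩
  have hsum : ∀ n : ℕ, ∑ k ∈ Finset.range n, (if decide (0 < e k) = true then u else v) - n * L
      = e n := by
    intro n
    induction n with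
    | zero => simp [e0]
    | succ n ih =>
      rw [Finset.sum_range_succ, es, ← ih]
      simp only [decide_eq_true_eq]
      push_cast
      ring
  rw [hsum n]
  induction n with
  | zero => rw [e0]; simp; linarith
  | succ n ih =>
    rw [es]
    rw [abs_le] at ih ⊢
    split_ifs with h <;> constructor <;> linarith

lemma greedy (u v L : ℝ) (h1 : min u v ≤ L) (h2 : L ≤ max u v) :
    ∃ w : ℕ → Bool, ∃ D : ℝ, ∀ n : ℕ,
      |∑ k ∈ Finset.range n, (if w k then u else v) - n * L| ≤ D := by
  rcases le_total u v with h | h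
  · rw [min_eq_left h] at h1
    rw [max_eq_right h] at h2
    exact greedy_aux u v L h1 h2
  · rw [min_eq_right h] at h1
    rw [max_eq_left h] at h2
    obtain ⟨w, D, hw⟩ := greedy_aux v u L h1 h2
    refine ⟨fun n => !(w n), D, fun n => ?_⟩
    have h3 : ∀ k, (if (!(w k)) = true then u else v) = (if w k = true then v else u) := by
      intro k
      cases w k <;> simp
    simp only [h3]
    exact hw n

/-- The coding sequence. -/
lemma coding (R c d : ℝ) (hR : 2 < R) (t : ℕ → ℝ)
    (hc : ∀ n, c ≤ c / R + t n) (hd : ∀ n, d / R + t n ≤ d) :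
    ∃ x : ℕ → ℝ, (∀ n, x n ∈ Icc c d) ∧ ∀ n, x n = x (n + 1) / R + t n := by
  have hR0 : 0 < R := by linarith
  have hr1 : R⁻¹ < 1 := inv_lt_one_of_one_lt₀ (by linarith)
  have hr0 : 0 ≤ R⁻¹ := by positivity
  have hg := hasSum_geometric_of_lt_one hr0 hr1
  have h1 : (1 - R⁻¹) ≠ 0 := by linarith
  have hlo : ∀ n, c * (1 - R⁻¹) ≤ t n := fun n => by
    have := hc n; rw [div_eq_mul_inv] at this; linarith
  have hhi : ∀ n, t n ≤ d * (1 - R⁻¹) := fun n => by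
    have := hd n; rw [div_eq_mul_inv] at this; linarith
  have hcs : HasSum (fun k : ℕ => c * (1 - R⁻¹) * R⁻¹ ^ k) c := by
    have := hg.mul_left (c * (1 - R⁻¹))
    rwa [mul_assoc, mul_inv_cancel₀ h1, mul_one] at this
  have hds : HasSum (fun k : ℕ => d * (1 - R⁻¹) * R⁻¹ ^ k) d := by
    have := hg.mul_left (d * (1 - R⁻¹))
    rwa [mul_assoc, mul_inv_cancel₀ h1, mul_one] at this
  have hsm : ∀ n, Summable (fun k : ℕ => t (n + k) * R⁻¹ ^ k) := by
    intro n
    have hb : Summable (fun k : ℕ => (t (n + k) - c * (1 - R⁻¹)) * R⁻¹ ^ k) := by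
      refine Summable.of_nonneg_of_le (fun k => ?_) (fun k => ?_) (hds.summable.sub hcs.summable)
      · have := hlo (n + k)
        exact mul_nonneg (by linarith) (by positivity)
      · rw [← sub_mul]
        have := hhi (n + k)
        gcongr
    refine (hb.add hcs.summable).congr (fun k => ?_)
    ring
  refine ⟨fun n => ∑' k, t (n + k) * R⁻¹ ^ k, fun n => ⟨?_, ?_⟩, fun n => ?_⟩
  · refine hasSum_le (fun k => ?_) hcs (hsm n).hasSum
    have := hlo (n + k)
    gcongr
  · refine hasSum_le (fun k => ?_) (hsm n).hasSum hds
    have := hhi (n + k)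
    gcongr
  · show ∑' k, t (n + k) * R⁻¹ ^ k = (∑' k, t (n + 1 + k) * R⁻¹ ^ k) / R + t n
    rw [(hsm n).tsum_eq_zero_add, div_eq_mul_inv, ← tsum_mul_right]
    simp only [add_zero, pow_zero, mul_one]
    rw [add_comm]
    congr 2
    funext k
    rw [show n + (k + 1) = n + 1 + k by ring, pow_succ]
    ring

lemma real_split (R a b p q : ℝ) (hp : 0 < p) (hq : 0 < q)
    (μ : Measure ℝ) [IsProbabilityMeasure μ]
    (hss : μ = ENNReal.ofReal p • μ.map (fun x : ℝ => x / R + a) +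
        ENNReal.ofReal q • μ.map (fun x : ℝ => x / R + b)) (s : Set ℝ) (hs : MeasurableSet s) :
    μ.real s = p * μ.real ((fun x : ℝ => x / R + a) ⁻¹' s)
      + q * μ.real ((fun x : ℝ => x / R + b) ⁻¹' s) := by
  have h : μ s = ENNReal.ofReal p * μ ((fun x : ℝ => x / R + a) ⁻¹' s)
      + ENNReal.ofReal q * μ ((fun x : ℝ => x / R + b) ⁻¹' s) := by
    conv_lhs => rw [hss]
    simp only [Measure.add_apply, Measure.smul_apply, smul_eq_mul]
    rw [Measure.map_apply (by fun_prop) hs, Measure.map_apply (by fun_prop) hs]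
  rw [measureReal_def, h, ENNReal.toReal_add
    (ENNReal.mul_ne_top ENNReal.ofReal_ne_top (measure_ne_top _ _))
    (ENNReal.mul_ne_top ENNReal.ofReal_ne_top (measure_ne_top _ _))]
  simp [ENNReal.toReal_mul, measureReal_def, hp.le, hq.le]

lemma supp (R a b c d p q : ℝ) (hR : 2 < R)
    (ha1 : c ≤ c / R + a) (ha2 : d / R + a ≤ d) (hb1 : c ≤ c / R + b) (hb2 : d / R + b ≤ d)
    (hp : 0 < p) (hq : 0 < q) (hpq : p + q = 1)
    (μ : Measure ℝ) [IsProbabilityMeasure μ]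
    (key : ∀ s : Set ℝ, MeasurableSet s → μ.real s = p * μ.real ((fun x : ℝ => x / R + a) ⁻¹' s)
      + q * μ.real ((fun x : ℝ => x / R + b) ⁻¹' s)) :
    μ (Icc c d)ᶜ = 0 := by
  have hR0 : 0 < R := by linarith
  let E : ℝ → Set ℝ := fun t => (Icc (c - t) (d + t))ᶜ
  have hEm : ∀ t, MeasurableSet (E t) := fun t => measurableSet_Icc.compl
  have hEanti : ∀ s t, s ≤ t → E t ⊆ E s := fun s t h =>
    compl_subset_compl.2 (Icc_subset_Icc (by linarith) (by linarith))
  have hpre : ∀ e, c ≤ c / R + e → d / R + e ≤ d → ∀ t,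
      (fun x : ℝ => x / R + e) ⁻¹' (E t) ⊆ E (R * t) := by
    intro e h1 h2 t x hx hx'
    apply hx
    obtain ⟨h3, h4⟩ := hx'
    have h5 : (c - R * t) / R ≤ x / R := by gcongr
    have h6 : x / R ≤ (d + R * t) / R := by gcongr
    rw [sub_div, mul_div_cancel_left₀ _ hR0.ne'] at h5
    rw [add_div, mul_div_cancel_left₀ _ hR0.ne'] at h6
    constructor <;> simp only <;> linarith
  have hstep : ∀ t, μ.real (E t) ≤ μ.real (E (R * t)) := by
    intro t
    rw [key _ (hEm t)]
    have h1 := measureReal_mono (μ := μ) (hpre a ha1 ha2 t)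
    have h2 := measureReal_mono (μ := μ) (hpre b hb1 hb2 t)
    calc _ ≤ p * μ.real (E (R * t)) + q * μ.real (E (R * t)) := by gcongr
      _ = _ := by rw [← add_mul, hpq, one_mul]
  have hiter : ∀ t (n : ℕ), μ.real (E t) ≤ μ.real (E (R ^ n * t)) := by
    intro t n
    induction n with
    | zero => simp
    | succ n ih =>
      refine ih.trans ((hstep _).trans (le_of_eq ?_))
      rw [pow_succ]; ring_nf
  have hzero : ∀ t, 0 < t → μ (E t) = 0 := by
    intro t ht
    have hanti : Antitone (fun n : ℕ => E (R ^ n * t)) := by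
      intro m n hmn
      apply hEanti
      have : R ^ m ≤ R ^ n := pow_le_pow_right₀ (by linarith) hmn
      gcongr
    have hlim := tendsto_measure_iInter_atTop (μ := μ)
      (fun n => (hEm (R ^ n * t)).nullMeasurableSet) hanti ⟨0, measure_ne_top _ _⟩
    have hemp : ⋂ n : ℕ, E (R ^ n * t) = ∅ := by
      rw [eq_empty_iff_forall_notMem]
      intro x hx
      rw [mem_iInter] at hx
      have hT : Tendsto (fun n : ℕ => R ^ n * t) atTop atTop :=
        (tendsto_pow_atTop_atTop_of_one_lt (by linarith)).atTop_mul_const ht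
      obtain ⟨n, hn⟩ := (hT.eventually_ge_atTop (|x - c| + |x - d|)).exists
      apply hx n
      have := neg_abs_le (x - c)
      have := le_abs_self (x - d)
      have := abs_nonneg (x - c)
      have := abs_nonneg (x - d)
      constructor <;> linarith
    rw [hemp, measure_empty] at hlim
    have hle : ∀ n : ℕ, μ (E t) ≤ μ (E (R ^ n * t)) := fun n => by
      have := hiter t n
      rwa [measureReal_def, measureReal_def,
        ENNReal.toReal_le_toReal (measure_ne_top _ _) (measure_ne_top _ _)] at this
    exact le_antisymm (ge_of_tendsto' hlim hle) bot_le
  refine measure_mono_null (t := ⋃ n : ℕ, E (1 / ((n : ℝ) + 1))) ?_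
    (measure_iUnion_null fun n => hzero _ (by positivity))
  intro x hx
  by_contra hcon
  simp only [mem_iUnion, not_exists] at hcon
  apply hx
  have h0 := tendsto_one_div_add_atTop_nhds_zero_nat (𝕜 := ℝ)
  have h1 : ∀ n : ℕ, x ∈ Icc (c - 1 / ((n : ℝ) + 1)) (d + 1 / ((n : ℝ) + 1)) :=
    fun n => not_not.1 (hcon n)
  constructor
  · have := h0.const_sub c
    rw [sub_zero] at this
    exact le_of_tendsto' this fun n => (h1 n).1
  · have := h0.const_add d
    rw [add_zero] at this
    exact ge_of_tendsto' this fun n => (h1 n).2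

lemma preimage_ball (R e y r : ℝ) (hR : 2 < R) :
    (fun x : ℝ => x / R + e) ⁻¹' Metric.ball (y / R + e) r = Metric.ball y (R * r) := by
  have hR0 : 0 < R := by linarith
  ext x
  simp only [mem_preimage, Metric.mem_ball, Real.dist_eq]
  rw [show x / R + e - (y / R + e) = (x - y) / R by ring, abs_div, abs_of_pos hR0,
    div_lt_iff₀ hR0, mul_comm]

/-- Analytic end of the argument. -/
lemma limit_of_bounds (R L D δ l : ℝ) (hR : 2 < R) (hδ : 0 < δ) (hl : 0 < l) (hL : L ≤ 0)
    (s : ℕ → ℝ) (hs : ∀ n : ℕ, |s n - n * L| ≤ D) (m : ℝ → ℝ)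
    (hlow : ∀ r > 0, ∀ n : ℕ, l < R ^ n * r → Real.exp (s n) ≤ m r)
    (hup : ∀ r > 0, ∀ n : ℕ, R ^ n * r ≤ δ → m r ≤ Real.exp (s n)) :
    (∀ r > 0, 0 < m r) ∧
    Tendsto (fun r => Real.log (m r) / Real.log r) (nhdsWithin 0 (Ioi 0))
      (nhds (L / Real.log (1 / R))) := by
  have hR0 : 0 < R := by linarith
  have hρ : 0 < Real.log R := Real.log_pos (by linarith)
  set ρ := Real.log R with hρdef
  have hpos : ∀ r > 0, 0 < m r := by
    intro r hr
    have hT : Tendsto (fun n : ℕ => R ^ n * r) atTop atTop :=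
      (tendsto_pow_atTop_atTop_of_one_lt (by linarith)).atTop_mul_const hr
    obtain ⟨n, hn⟩ := (hT.eventually_gt_atTop l).exists
    exact (Real.exp_pos _).trans_le (hlow r hr n hn)
  refine ⟨hpos, ?_⟩
  have hlogpow : ∀ r > 0, ∀ n : ℕ, Real.log (R ^ n * r) = n * ρ + Real.log r := by
    intro r hr n
    rw [Real.log_mul (by positivity) hr.ne', Real.log_pow]
  -- main estimate
  obtain ⟨C, hC⟩ : ∃ C : ℝ, ∀ᶠ r in nhdsWithin (0 : ℝ) (Ioi 0),
      |Real.log (m r) + Real.log r * (L / ρ)| ≤ C := by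
    refine ⟨D + |L| + |Real.log l * (L / ρ)| + |Real.log δ * (L / ρ)| , ?_⟩
    have hbot : ∀ᶠ r in nhdsWithin (0 : ℝ) (Ioi 0), Real.log r ≤ min (Real.log l) (Real.log δ) :=
      Real.tendsto_log_nhdsGT_zero.eventually_le_atBot _
    filter_upwards [hbot, self_mem_nhdsWithin] with r hr hr0
    have hr0 : 0 < r := hr0
    have hA1 := abs_nonneg (Real.log l * (L / ρ))
    have hA2 := abs_nonneg (Real.log δ * (L / ρ))
    rw [abs_of_nonpos hL, abs_le]
    constructor
    · set y := (Real.log l - Real.log r) / ρ with hy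
      have hy0 : 0 ≤ y := div_nonneg (by linarith [min_le_left (Real.log l) (Real.log δ)]) hρ.le
      have h1 : y < (⌊y⌋₊ + 1 : ℕ) := by push_cast; exact Nat.lt_floor_add_one y
      have h2 : ((⌊y⌋₊ + 1 : ℕ) : ℝ) ≤ y + 1 := by
        push_cast; linarith [Nat.floor_le hy0]
      set n := ⌊y⌋₊ + 1
      have h3 : l < R ^ n * r := by
        rw [← Real.log_lt_log_iff hl (by positivity), hlogpow r hr0]
        rw [hy, div_lt_iff₀ hρ] at h1
        linarith
      have h4 : s n ≤ Real.log (m r) := by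
        rw [Real.le_log_iff_exp_le (hpos r hr0)]; exact hlow r hr0 n h3
      have h5 := (abs_le.1 (hs n)).1
      have h6 : (y + 1) * L ≤ n * L := mul_le_mul_of_nonpos_right h2 hL
      have h7 : y * L = Real.log l * (L / ρ) - Real.log r * (L / ρ) := by rw [hy]; ring
      have := neg_abs_le (Real.log l * (L / ρ))
      linarith
    · set y := (Real.log δ - Real.log r) / ρ with hy
      have hy0 : 0 ≤ y := div_nonneg (by linarith [min_le_right (Real.log l) (Real.log δ)]) hρ.le
      have h1 : (⌊y⌋₊ : ℝ) ≤ y := Nat.floor_le hy0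
      have h2 : y - 1 ≤ (⌊y⌋₊ : ℝ) := by linarith [Nat.lt_floor_add_one y]
      set n := ⌊y⌋₊
      have h3 : R ^ n * r ≤ δ := by
        rw [← Real.log_le_log_iff (by positivity) hδ, hlogpow r hr0]
        rw [hy, le_div_iff₀ hρ] at h1
        linarith
      have h4 : Real.log (m r) ≤ s n := by
        rw [Real.log_le_iff_le_exp (hpos r hr0)]; exact hup r hr0 n h3
      have h5 := (abs_le.1 (hs n)).2
      have h6 : n * L ≤ (y - 1) * L := mul_le_mul_of_nonpos_right h2 hL
      have h7 : y * L = Real.log δ * (L / ρ) - Real.log r * (L / ρ) := by rw [hy]; ring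
      have := le_abs_self (Real.log δ * (L / ρ))
      linarith
  have hα : L / Real.log (1 / R) = -(L / ρ) := by
    rw [one_div, Real.log_inv, div_neg]
  rw [hα, tendsto_iff_norm_sub_tendsto_zero]
  have habs : Tendsto (fun r : ℝ => C / |Real.log r|) (nhdsWithin 0 (Ioi 0)) (nhds 0) :=
    (tendsto_abs_atBot_atTop.comp Real.tendsto_log_nhdsGT_zero).const_div_atTop C
  refine squeeze_zero' (Eventually.of_forall fun _ => norm_nonneg _) ?_ habs
  filter_upwards [hC, Real.tendsto_log_nhdsGT_zero.eventually_lt_atBot 0] with r h1 h2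
  have h3 : Real.log (m r) / Real.log r - -(L / ρ)
      = (Real.log (m r) + Real.log r * (L / ρ)) / Real.log r := by
    field_simp [h2.ne]
    ring
  rw [h3, Real.norm_eq_abs, abs_div]
  gcongr

end LocDim

/-- for the self-similar measure of a two-map IFS with ratio `1/R`
satisfying the strong separation condition and probabilities `p, q = 1 - p`,
the set of attainable local dimensions contains the closed interval
`[log(max(p,q))/log(1/R), log(min(p,q))/log(1/R)]`. -/
theorem stmt_7 (R a b c d p q : ℝ) (hR : 2 < R) (hcd : c < d)
    (hmapsa : Set.MapsTo (fun x : ℝ => x / R + a) (Set.Icc c d) (Set.Icc c d))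
    (hmapsb : Set.MapsTo (fun x : ℝ => x / R + b) (Set.Icc c d) (Set.Icc c d))
    (hdisj : Disjoint ((fun x : ℝ => x / R + a) '' Set.Icc c d)
        ((fun x : ℝ => x / R + b) '' Set.Icc c d))
    (hp : 0 < p) (hq : 0 < q) (hpq : p + q = 1)
    (μ : Measure ℝ) [IsProbabilityMeasure μ]
    (hss : μ = ENNReal.ofReal p • μ.map (fun x : ℝ => x / R + a) +
        ENNReal.ofReal q • μ.map (fun x : ℝ => x / R + b)) :
    ∀ α ∈ Set.Icc (Real.log (max p q) / Real.log (1 / R))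
        (Real.log (min p q) / Real.log (1 / R)),
      ∃ x : ℝ, (∀ ε > 0, 0 < μ (Metric.ball x ε)) ∧
        Filter.Tendsto
          (fun r : ℝ => Real.log (μ (Metric.ball x r)).toReal / Real.log r)
          (nhdsWithin 0 (Set.Ioi 0)) (nhds α) := by
  intro α hα
  have hR0 : 0 < R := by linarith
  have hc : c ∈ Icc c d := left_mem_Icc.2 hcd.le
  have hd : d ∈ Icc c d := right_mem_Icc.2 hcd.le
  have ha1 : c ≤ c / R + a := (hmapsa hc).1
  have ha2 : d / R + a ≤ d := (hmapsa hd).2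
  have hb1 : c ≤ c / R + b := (hmapsb hc).1
  have hb2 : d / R + b ≤ d := (hmapsb hd).2
  have key := LocDim.real_split R a b p q hp hq μ hss
  have hsupp := LocDim.supp R a b c d p q hR ha1 ha2 hb1 hb2 hp hq hpq μ key
  have hρ : 0 < Real.log R := Real.log_pos (by linarith)
  -- the gap
  obtain ⟨δ, hδ, hgap⟩ := Metric.exists_pos_forall_lt_edist
    (isCompact_Icc.image (by fun_prop : Continuous fun x : ℝ => x / R + a))
    (isCompact_Icc.image (by fun_prop : Continuous fun x : ℝ => x / R + b)).isClosed hdisj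
  have hgap' : ∀ y ∈ Icc c d, ∀ z ∈ Icc c d, (δ : ℝ) < |(y / R + a) - (z / R + b)| := by
    intro y hy z hz
    have := hgap _ (mem_image_of_mem _ hy) _ (mem_image_of_mem _ hz)
    rw [edist_nndist, ENNReal.coe_lt_coe, ← NNReal.coe_lt_coe, coe_nndist, Real.dist_eq] at this
    exact this
  -- the digits
  have hlogR : Real.log (1 / R) = -Real.log R := by rw [one_div, Real.log_inv]
  set L := α * Real.log (1 / R) with hLdef
  have hneg : Real.log (1 / R) < 0 := by rw [hlogR]; linarith
  have hαL : α = L / Real.log (1 / R) := by rw [hLdef, mul_div_cancel_right₀ _ hneg.ne]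
  have hmax : L ≤ Real.log (max p q) := by
    have := hα.1
    rwa [div_le_iff_of_neg hneg] at this
  have hmin : Real.log (min p q) ≤ L := by
    have := hα.2
    rwa [le_div_iff_of_neg hneg] at this
  have hL0 : L ≤ 0 := hmax.trans (Real.log_nonpos (by positivity)
    (max_le (by linarith) (by linarith)))
  have hmax' : L ≤ max (Real.log p) (Real.log q) := by
    rcases max_cases p q with h | h <;> rw [h.1] at hmax <;> simp [hmax]
  have hmin' : min (Real.log p) (Real.log q) ≤ L := by
    rcases min_cases p q with h | h <;> rw [h.1] at hmin <;> simp [hmin]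
  obtain ⟨w, D, hw⟩ := LocDim.greedy (Real.log p) (Real.log q) L hmin' hmax'
  obtain ⟨x, hxI, hx⟩ := LocDim.coding R c d hR (fun n => if w n then a else b)
    (fun n => by split_ifs <;> assumption)
    (fun n => by split_ifs <;> assumption)
  set s : ℕ → ℝ := fun n => ∑ k ∈ Finset.range n, (if w k then Real.log p else Real.log q)
    with hsdef
  have hs0 : s 0 = 0 := by simp [hsdef]
  have hexp : ∀ n, Real.exp (s (n + 1)) = Real.exp (s n) * (if w n then p else q) := by
    intro n
    simp only [hsdef, Finset.sum_range_succ, Real.exp_add]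
    split_ifs
    · rw [Real.exp_log hp]
    · rw [Real.exp_log hq]
  -- one step
  have hge : ∀ n r, (if w n then p else q) * μ.real (Metric.ball (x (n + 1)) (R * r))
      ≤ μ.real (Metric.ball (x n) r) := by
    intro n r
    rw [key (Metric.ball (x n) r) measurableSet_ball, hx n]
    by_cases h : w n
    · simp only [h, if_true]
      rw [LocDim.preimage_ball R a _ r hR]
      have : 0 ≤ q * μ.real ((fun x : ℝ => x / R + b) ⁻¹' Metric.ball (x (n + 1) / R + a) r) := by
        positivity
      linarith
    · simp only [h]
      simp only [Bool.false_eq_true, if_false]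
      rw [LocDim.preimage_ball R b _ r hR]
      have : 0 ≤ p * μ.real ((fun x : ℝ => x / R + a) ⁻¹' Metric.ball (x (n + 1) / R + b) r) := by
        positivity
      linarith
  have hle : ∀ n r, r ≤ (δ : ℝ) → μ.real (Metric.ball (x n) r)
      ≤ (if w n then p else q) * μ.real (Metric.ball (x (n + 1)) (R * r)) := by
    intro n r hr
    rw [key (Metric.ball (x n) r) measurableSet_ball, hx n]
    by_cases h : w n
    · simp only [h, if_true]
      rw [LocDim.preimage_ball R a _ r hR]
      have : μ.real ((fun x : ℝ => x / R + b) ⁻¹' Metric.ball (x (n + 1) / R + a) r) = 0 := by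
        rw [measureReal_def, measure_mono_null _ hsupp, ENNReal.toReal_zero]
        intro z hz hzI
        have h1 := hgap' _ (hxI (n + 1)) z hzI
        rw [mem_preimage, Metric.mem_ball', Real.dist_eq] at hz
        linarith
      rw [this]; linarith
    · simp only [h]
      simp only [Bool.false_eq_true, if_false]
      rw [LocDim.preimage_ball R b _ r hR]
      have : μ.real ((fun x : ℝ => x / R + a) ⁻¹' Metric.ball (x (n + 1) / R + b) r) = 0 := by
        rw [measureReal_def, measure_mono_null _ hsupp, ENNReal.toReal_zero]
        intro z hz hzI
        have h1 := hgap' z hzI _ (hxI (n + 1))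
        rw [mem_preimage, Metric.mem_ball, Real.dist_eq] at hz
        linarith
      rw [this]; linarith
  have hgeN : ∀ n : ℕ, ∀ r, Real.exp (s n) * μ.real (Metric.ball (x n) (R ^ n * r))
      ≤ μ.real (Metric.ball (x 0) r) := by
    intro n r
    induction n with
    | zero => simp [hs0]
    | succ n ih =>
      refine le_trans ?_ ih
      rw [hexp, mul_assoc, show R ^ (n + 1) * r = R * (R ^ n * r) by ring]
      exact mul_le_mul_of_nonneg_left (hge n _) (Real.exp_pos _).le
  have hleN : ∀ n : ℕ, ∀ r > 0, R ^ n * r ≤ (δ : ℝ) → μ.real (Metric.ball (x 0) r) ≤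
      Real.exp (s n) * μ.real (Metric.ball (x n) (R ^ n * r)) := by
    intro n r hr
    induction n with
    | zero => intro _; simp [hs0]
    | succ n ih =>
      intro h
      have h1 : R ^ n * r ≤ δ := by
        refine le_trans ?_ h
        have : R ^ n ≤ R ^ (n + 1) := pow_le_pow_right₀ (by linarith) (Nat.le_succ n)
        gcongr
      refine (ih h1).trans ?_
      rw [hexp, mul_assoc, show R ^ (n + 1) * r = R * (R ^ n * r) by ring]
      exact mul_le_mul_of_nonneg_left (hle n _ h1) (Real.exp_pos _).le
  have hIcc : μ.real (Icc c d) = 1 := by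
    rw [measureReal_def, (prob_compl_eq_zero_iff measurableSet_Icc).1 hsupp, ENNReal.toReal_one]
  obtain ⟨hpos, hlim⟩ := LocDim.limit_of_bounds R L D δ (d - c) hR (by exact_mod_cast hδ)
    (by linarith) hL0 s hw (fun r => μ.real (Metric.ball (x 0) r))
    (fun r hr n hn => by
      refine le_trans ?_ (hgeN n r)
      have h1 : μ.real (Icc c d) ≤ μ.real (Metric.ball (x n) (R ^ n * r)) := by
        refine measureReal_mono ?_
        intro z hz
        rw [Metric.mem_ball, Real.dist_eq, abs_lt]
        obtain ⟨h2, h3⟩ := hxI n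
        obtain ⟨h4, h5⟩ := hz
        constructor <;> linarith
      rw [hIcc] at h1
      exact le_mul_of_one_le_right (Real.exp_pos _).le h1)
    (fun r hr n hn => (hleN n r hr hn).trans
      (mul_le_of_le_one_right (Real.exp_pos _).le measureReal_le_one))
  refine ⟨x 0, fun ε hε => ?_, ?_⟩
  · have := hpos ε hε
    exact (ENNReal.toReal_pos_iff.1 this).1
  · rw [hαL]
    exact hlim
end

section
/- Let μ be the self-similar measure of a two-map IFS with ratio 1/R satisfying the strong separation condition and probabilities p, q > 0 (p + q = 1). Then its L^q-spectrum is τ_μ(t) = −log(p^t + q^t)/log R for all t ∈ ℝ, and in particular τ_μ(0) = −log 2/log R equals minus the Hausdorff (and box) dimension of the support. -/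
open Set MeasureTheory Filter

/-- The supremum of `∑ μ(B(xᵢ,r))^t` over finite disjoint families of `r`-balls
centered at points of the (topological) support of `μ`. -/
noncomputable def packingSum (μ : MeasureTheory.Measure ℝ) (t r : ℝ) : ℝ :=
  ⨆ s : Finset ℝ, ⨆ _ : (∀ x ∈ s, ∀ ε > 0, 0 < μ (Metric.ball x ε)) ∧
      (s : Set ℝ).Pairwise (fun x y => Disjoint (Metric.ball x r) (Metric.ball y r)),
    ∑ x ∈ s, (μ (Metric.ball x r)).toReal ^ t

/-- The `L^q`-spectrum `τ_μ(t) = liminf_{r→0⁺} log(sup ∑ μ(B(xᵢ,r))^t)/log r`. -/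
noncomputable def lqSpectrum (μ : MeasureTheory.Measure ℝ) (t : ℝ) : ℝ :=
  Filter.liminf (fun r : ℝ => Real.log (packingSum μ t r) / Real.log r)
    (nhdsWithin 0 (Set.Ioi 0))

/-- membership in the topological support -/
def InSupp (μ : Measure ℝ) (x : ℝ) : Prop := ∀ ε > 0, 0 < μ (Metric.ball x ε)

/-- admissible packings -/
def IsPack (μ : Measure ℝ) (r : ℝ) (s : Finset ℝ) : Prop :=
  (∀ x ∈ s, ∀ ε > 0, 0 < μ (Metric.ball x ε)) ∧
      (s : Set ℝ).Pairwise (fun x y => Disjoint (Metric.ball x r) (Metric.ball y r))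

lemma packingSum_le {μ : Measure ℝ} {t r B : ℝ} (hB : 0 ≤ B)
    (h : ∀ s, IsPack μ r s → ∑ x ∈ s, (μ (Metric.ball x r)).toReal ^ t ≤ B) :
    packingSum μ t r ≤ B := by
  unfold packingSum
  refine Real.iSup_le (fun s => Real.iSup_le (fun hs => h s hs) hB) hB

lemma le_packingSum {μ : Measure ℝ} {t r B : ℝ} (hB : 0 ≤ B)
    (h : ∀ s, IsPack μ r s → ∑ x ∈ s, (μ (Metric.ball x r)).toReal ^ t ≤ B)
    {s : Finset ℝ} (hs : IsPack μ r s) :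
    ∑ x ∈ s, (μ (Metric.ball x r)).toReal ^ t ≤ packingSum μ t r := by
  unfold packingSum
  have hb : BddAbove (Set.range fun s : Finset ℝ =>
      ⨆ _ : (∀ x ∈ s, ∀ ε > 0, 0 < μ (Metric.ball x ε)) ∧
      (s : Set ℝ).Pairwise (fun x y => Disjoint (Metric.ball x r) (Metric.ball y r)),
      ∑ x ∈ s, (μ (Metric.ball x r)).toReal ^ t) := by
    refine ⟨B, ?_⟩
    rintro _ ⟨s, rfl⟩
    exact Real.iSup_le (fun hs => h s hs) hB
  refine le_trans ?_ (le_ciSup hb s)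
  have hs' : (∀ x ∈ s, ∀ ε > 0, 0 < μ (Metric.ball x ε)) ∧
      (s : Set ℝ).Pairwise (fun x y => Disjoint (Metric.ball x r) (Metric.ball y r)) := hs
  simp only [ciSup_pos hs', le_refl]

lemma inSupp_mem {μ : Measure ℝ} {K : Set ℝ} (hK : IsClosed K) (h0 : μ Kᶜ = 0) {x : ℝ}
    (hx : InSupp μ x) : x ∈ K := by
  by_contra hxK
  obtain ⟨ε, hε, hsub⟩ := Metric.isOpen_iff.1 hK.isOpen_compl x hxK
  have := hx ε hε
  exact absurd (measure_mono_null hsub h0) this.ne'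

lemma exists_inSupp {μ : Measure ℝ} [IsProbabilityMeasure μ] {K : Set ℝ} (hK : IsCompact K)
    (h0 : μ Kᶜ = 0) : ∃ x, InSupp μ x := by
  by_contra hcon
  have h1 : μ K = 0 := by
    refine hK.measure_zero_of_nhdsWithin (fun x _ => ?_)
    have hx : ¬ InSupp μ x := fun h => hcon ⟨x, h⟩
    unfold InSupp at hx
    push Not at hx
    obtain ⟨ε, hε, hle⟩ := hx
    exact ⟨Metric.ball x ε, mem_nhdsWithin_of_mem_nhds (Metric.ball_mem_nhds x hε),
      le_antisymm hle bot_le⟩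
  have h2 : μ (K ∪ Kᶜ) = 0 := measure_union_null h1 h0
  rw [Set.union_compl_self] at h2
  simp at h2

lemma exists_lower {μ : Measure ℝ} [IsProbabilityMeasure μ] {K : Set ℝ} (hK : IsCompact K)
    (h0 : μ Kᶜ = 0) {ρ : ℝ} (hρ : 0 < ρ) :
    ∃ m : ℝ, 0 < m ∧ ∀ x, InSupp μ x → m ≤ (μ (Metric.ball x ρ)).toReal := by
  obtain ⟨T, -, hT⟩ := hK.elim_nhds_subcover (fun x => Metric.ball x (ρ/2))
    (fun x _ => Metric.ball_mem_nhds x (by positivity))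
  have hfin : ∃ m : ℝ, 0 < m ∧ ∀ y ∈ T, 0 < (μ (Metric.ball y (ρ/2))).toReal →
      m ≤ (μ (Metric.ball y (ρ/2))).toReal := by
    clear hT
    induction T using Finset.induction_on with
    | empty => exact ⟨1, one_pos, by simp⟩
    | insert z T hz ih =>
      obtain ⟨m, hm, h⟩ := ih
      by_cases hzp : 0 < (μ (Metric.ball z (ρ/2))).toReal
      · refine ⟨min m (μ (Metric.ball z (ρ/2))).toReal, lt_min hm hzp, ?_⟩
        intro y hy hyp
        rcases Finset.mem_insert.1 hy with rfl | hy
        · exact min_le_right _ _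
        · exact (min_le_left _ _).trans (h y hy hyp)
      · refine ⟨m, hm, ?_⟩
        intro y hy hyp
        rcases Finset.mem_insert.1 hy with rfl | hy
        · exact absurd hyp hzp
        · exact h y hy hyp
  obtain ⟨m, hm, h⟩ := hfin
  refine ⟨m, hm, fun x hx => ?_⟩
  have hxK := hT (inSupp_mem hK.isClosed h0 hx)
  simp only [Set.mem_iUnion] at hxK
  obtain ⟨y, hy, hxy⟩ := hxK
  have hsub : Metric.ball y (ρ/2) ⊆ Metric.ball x ρ := by
    intro z hz
    rw [Metric.mem_ball] at *
    have := dist_triangle_right z x y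
    linarith
  have hpos : 0 < μ (Metric.ball y (ρ/2)) := by
    obtain ⟨ε, hε, hs⟩ := Metric.isOpen_iff.1 (Metric.isOpen_ball (x := y) (ε := ρ/2)) x hxy
    exact (hx ε hε).trans_le (measure_mono hs)
  have h1 := h y hy (ENNReal.toReal_pos hpos.ne' (measure_ne_top _ _))
  exact h1.trans (ENNReal.toReal_mono (measure_ne_top _ _) (measure_mono hsub))

lemma rpow_upper {m v t : ℝ} (hm : 0 < m) (hv : m ≤ v) (hv1 : v ≤ 1) : v ^ t ≤ 1 + m ^ t := by
  rcases le_total 0 t with ht | ht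
  · have := Real.rpow_le_one (hm.le.trans hv) hv1 ht
    have := Real.rpow_pos_of_pos hm t
    linarith
  · have := Real.rpow_le_rpow_of_nonpos hm hv ht
    linarith

lemma rpow_lower {m v t : ℝ} (hm : 0 < m) (hv : m ≤ v) (hv1 : v ≤ 1) : min 1 (m ^ t) ≤ v ^ t := by
  rcases le_total 0 t with ht | ht
  · exact (min_le_right _ _).trans (Real.rpow_le_rpow hm.le hv ht)
  · exact (min_le_left _ _).trans
      (Real.one_le_rpow_of_pos_of_le_one_of_nonpos (hm.trans_le hv) hv1 ht)

lemma toReal_le_one' (μ : Measure ℝ) [IsProbabilityMeasure μ] (s : Set ℝ) : (μ s).toReal ≤ 1 :=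
  ENNReal.toReal_le_of_le_ofReal one_pos.le (by simpa using prob_le_one)

lemma pack_bound {μ : Measure ℝ} [IsProbabilityMeasure μ] {m ρ r t : ℝ} (hm : 0 < m)
    (hmρ : ∀ x, InSupp μ x → m ≤ (μ (Metric.ball x ρ)).toReal) (hr : ρ ≤ r)
    (s : Finset ℝ) (hs : IsPack μ r s) :
    ∑ x ∈ s, (μ (Metric.ball x r)).toReal ^ t ≤ (1 + m ^ t) / m := by
  have hv : ∀ x ∈ s, m ≤ (μ (Metric.ball x r)).toReal := fun x hx =>
    (hmρ x (hs.1 x hx)).trans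
      (ENNReal.toReal_mono (measure_ne_top _ _) (measure_mono (Metric.ball_subset_ball hr)))
  have hsum : ∑ x ∈ s, (μ (Metric.ball x r)).toReal ≤ 1 := by
    have h1 := measure_biUnion_finset (μ := μ) (s := s) (f := fun x => Metric.ball x r) hs.2
      (fun x _ => Metric.isOpen_ball.measurableSet)
    rw [← ENNReal.toReal_sum (fun x _ => measure_ne_top _ _), ← h1]
    exact toReal_le_one' μ _
  have hpos : 0 < m ^ t := Real.rpow_pos_of_pos hm t
  calc ∑ x ∈ s, (μ (Metric.ball x r)).toReal ^ t
      ≤ ∑ x ∈ s, (1 + m ^ t) / m * (μ (Metric.ball x r)).toReal := by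
        refine Finset.sum_le_sum (fun x hx => ?_)
        refine (rpow_upper hm (hv x hx) (toReal_le_one' μ _)).trans ?_
        rw [div_mul_eq_mul_div, le_div_iff₀ hm]
        exact mul_le_mul_of_nonneg_left (hv x hx) (by positivity)
    _ = (1 + m ^ t) / m * ∑ x ∈ s, (μ (Metric.ball x r)).toReal := by rw [Finset.mul_sum]
    _ ≤ (1 + m ^ t) / m * 1 := mul_le_mul_of_nonneg_left hsum (by positivity)
    _ = _ := mul_one _

/-- the main limit argument -/
lemma limit_of_recursion {P : ℝ → ℝ} {R A ρ L U : ℝ} (hR : 1 < R) (hA : 0 < A) (hρ : 0 < ρ)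
    (hL : 0 < L) (hb : ∀ r, ρ ≤ r → L ≤ P r ∧ P r ≤ U) (hpos : ∀ r, 0 < r → 0 < P r)
    (hrec : ∀ r, 0 < r → r ≤ ρ → P r = A * P (R * r)) :
    Tendsto (fun r => Real.log (P r) / Real.log r) (nhdsWithin 0 (Set.Ioi 0))
      (nhds (-Real.log A / Real.log R)) := by
  have hlR : 0 < Real.log R := Real.log_pos hR
  set h : ℝ → ℝ := fun r => Real.log (P r) + Real.log A / Real.log R * Real.log r with hh
  have hR0 : 0 < R := by linarith
  have hrec' : ∀ r, 0 < r → r ≤ ρ → h r = h (R * r) := by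
    intro r hr hrρ
    have : 0 < R * r := by positivity
    simp only [hh]
    rw [hrec r hr hrρ, Real.log_mul hA.ne' (hpos _ this).ne', Real.log_mul hR0.ne' hr.ne']
    field_simp
    ring
  obtain ⟨C, hC⟩ : ∃ C, ∀ r, ρ ≤ r → r ≤ R * ρ → |h r| ≤ C := by
    refine ⟨(|Real.log L| + |Real.log U|) +
      |Real.log A / Real.log R| * (|Real.log ρ| + |Real.log (R * ρ)|), ?_⟩
    intro r h1 h2
    have aux : ∀ x y z : ℝ, x ≤ y → y ≤ z → |y| ≤ |x| + |z| := by
      intro x y z hx hy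
      rw [abs_le]
      constructor
      · linarith [neg_abs_le x, abs_nonneg z]
      · linarith [le_abs_self z, abs_nonneg x]
    have hr : 0 < r := by linarith
    refine (abs_add_le _ _).trans (add_le_add ?_ ?_)
    · exact aux _ _ _ (Real.log_le_log hL (hb r h1).1) (Real.log_le_log (hpos r hr) (hb r h1).2)
    · rw [abs_mul]
      exact mul_le_mul_of_nonneg_left
        (aux _ _ _ (Real.log_le_log hρ h1) (Real.log_le_log hr h2)) (abs_nonneg _)
  have hn : ∀ n : ℕ, ∀ r, ρ ≤ R ^ n * r → 0 < r → r ≤ R * ρ → |h r| ≤ C := by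
    intro n
    induction n with
    | zero => intro r h1 h2 h3; exact hC r (by simpa using h1) h3
    | succ n ih =>
      intro r h1 h2 h3
      rcases le_total ρ r with h4 | h4
      · exact hC r h4 h3
      · rw [hrec' r h2 h4]
        refine ih _ ?_ (by positivity) (by gcongr)
        rw [pow_succ, mul_assoc] at h1
        exact h1
  have hall : ∀ r, 0 < r → r ≤ R * ρ → |h r| ≤ C := by
    intro r h1 h2
    obtain ⟨n, hn'⟩ := pow_unbounded_of_one_lt (ρ / r) hR
    refine hn n r ?_ h1 h2
    exact ((div_lt_iff₀ h1).1 hn').le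
  have hlog : Tendsto Real.log (nhdsWithin 0 (Set.Ioi 0)) atBot := Real.tendsto_log_nhdsGT_zero
  have hinv : Tendsto (fun r => (Real.log r)⁻¹) (nhdsWithin 0 (Set.Ioi 0)) (nhds 0) :=
    tendsto_inv_atBot_zero.comp hlog
  have hbd : ∀ᶠ r in nhdsWithin (0:ℝ) (Set.Ioi 0), |h r| ≤ C := by
    filter_upwards [Ioo_mem_nhdsGT (show (0:ℝ) < R * ρ by positivity)] with r hr
    exact hall r hr.1 hr.2.le
  have hz : Tendsto (fun r => h r * (Real.log r)⁻¹) (nhdsWithin 0 (Set.Ioi 0)) (nhds 0) := by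
    refine squeeze_zero_norm' (a := fun r => C * |(Real.log r)⁻¹|) ?_ ?_
    · filter_upwards [hbd] with r hr
      rw [norm_mul]
      exact mul_le_mul_of_nonneg_right hr (abs_nonneg _)
    · have := (hinv.abs).const_mul C
      simpa using this
  have hfin := hz.add_const (-Real.log A / Real.log R)
  rw [zero_add] at hfin
  refine hfin.congr' ?_
  filter_upwards [hlog.eventually_lt_atBot 0] with r hr
  simp only [hh]
  have := hr.ne
  field_simp
  ring

lemma affine_ball_preimage {R a y r : ℝ} (hR : 0 < R) :
    (fun x : ℝ => x / R + a) ⁻¹' Metric.ball (y / R + a) r = Metric.ball y (R * r) := by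
  ext x
  simp only [Set.mem_preimage, Metric.mem_ball, Real.dist_eq]
  have : x / R + a - (y / R + a) = (x - y) / R := by ring
  rw [this, abs_div, abs_of_pos hR, div_lt_iff₀ hR, mul_comm]

/-- one step of self-similarity for a set -/
lemma ss_apply {R a b p q : ℝ} {μ : Measure ℝ} 
    (hss : μ = ENNReal.ofReal p • μ.map (fun x : ℝ => x / R + a) +
        ENNReal.ofReal q • μ.map (fun x : ℝ => x / R + b)) {s : Set ℝ} (hs : MeasurableSet s) :
    μ s = ENNReal.ofReal p * μ ((fun x : ℝ => x / R + a) ⁻¹' s) +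
      ENNReal.ofReal q * μ ((fun x : ℝ => x / R + b) ⁻¹' s) := by
  have ha : Measurable (fun x : ℝ => x / R + a) := by fun_prop
  have hb : Measurable (fun x : ℝ => x / R + b) := by fun_prop
  conv_lhs => rw [hss]
  simp [Measure.map_apply ha hs, Measure.map_apply hb hs]

lemma compl_null {R a b c d p q : ℝ} {μ : Measure ℝ} [IsProbabilityMeasure μ] (hR : 1 < R)
    (hcd : c < d)
    (hmapsa : Set.MapsTo (fun x : ℝ => x / R + a) (Set.Icc c d) (Set.Icc c d))
    (hmapsb : Set.MapsTo (fun x : ℝ => x / R + b) (Set.Icc c d) (Set.Icc c d))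
    (hp : 0 < p) (hq : 0 < q) (hpq : p + q = 1)
    (hss : μ = ENNReal.ofReal p • μ.map (fun x : ℝ => x / R + a) +
        ENNReal.ofReal q • μ.map (fun x : ℝ => x / R + b)) : μ (Set.Icc c d)ᶜ = 0 := by
  have hR0 : 0 < R := by linarith
  have key : ∀ e : ℝ, Set.MapsTo (fun x : ℝ => x / R + e) (Set.Icc c d) (Set.Icc c d) →
      ∀ M, (fun x : ℝ => x / R + e) ⁻¹' (Set.Icc (c - M) (d + M))ᶜ ⊆
        (Set.Icc (c - R * M) (d + R * M))ᶜ := by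
    intro e he M x hx hx'
    apply hx
    have h1 := (he (Set.left_mem_Icc.2 hcd.le)).1
    have h2 := (he (Set.right_mem_Icc.2 hcd.le)).2
    simp only at h1 h2
    have h3 : (c - R * M) / R ≤ x / R := by gcongr; exact hx'.1
    have h4 : x / R ≤ (d + R * M) / R := by gcongr; exact hx'.2
    have h5 : (c - R * M) / R = c / R - M := by field_simp
    have h6 : (d + R * M) / R = d / R + M := by field_simp
    constructor <;> linarith
  have step : ∀ M, μ (Set.Icc (c - M) (d + M))ᶜ ≤ μ (Set.Icc (c - R * M) (d + R * M))ᶜ := by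
    intro M
    rw [ss_apply hss measurableSet_Icc.compl]
    calc _ ≤ ENNReal.ofReal p * μ (Set.Icc (c - R * M) (d + R * M))ᶜ +
          ENNReal.ofReal q * μ (Set.Icc (c - R * M) (d + R * M))ᶜ := by
          gcongr
          · exact key a hmapsa M
          · exact key b hmapsb M
      _ = _ := by
          rw [← add_mul, ← ENNReal.ofReal_add hp.le hq.le, hpq, ENNReal.ofReal_one, one_mul]
  have stepn : ∀ M, ∀ n : ℕ, μ (Set.Icc (c - M) (d + M))ᶜ ≤
      μ (Set.Icc (c - R ^ n * M) (d + R ^ n * M))ᶜ := by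
    intro M n
    induction n with
    | zero => simp
    | succ n ih =>
      refine ih.trans ((step _).trans (le_of_eq ?_))
      rw [pow_succ', mul_assoc]
  have hM : ∀ M : ℝ, 0 < M → μ (Set.Icc (c - M) (d + M))ᶜ = 0 := by
    intro M hM0
    have hanti : Antitone (fun n : ℕ => (Set.Icc (c - R ^ n * M) (d + R ^ n * M))ᶜ) := by
      intro m n hmn
      apply Set.compl_subset_compl.2
      have : R ^ m * M ≤ R ^ n * M := by gcongr; exact hR.le
      exact Set.Icc_subset_Icc (by linarith) (by linarith)
    have ht := tendsto_measure_iInter_atTop (μ := μ)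
      (fun n => (measurableSet_Icc.compl).nullMeasurableSet) hanti ⟨0, measure_ne_top _ _⟩
    have hempty : (⋂ n : ℕ, (Set.Icc (c - R ^ n * M) (d + R ^ n * M))ᶜ) = ∅ := by
      rw [Set.eq_empty_iff_forall_notMem]
      intro x hx
      rw [Set.mem_iInter] at hx
      obtain ⟨n, hn⟩ := pow_unbounded_of_one_lt ((|x| + |c| + |d|) / M) hR
      rw [div_lt_iff₀ hM0] at hn
      apply hx n
      have := abs_le.1 (le_refl |x|)
      have := abs_le.1 (le_refl |c|)
      have := abs_le.1 (le_refl |d|)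
      constructor <;> linarith [abs_nonneg x, abs_nonneg c, abs_nonneg d]
    rw [hempty, measure_empty] at ht
    exact le_antisymm (ge_of_tendsto' ht (fun n => stepn M n)) bot_le
  have hU : (Set.Icc c d)ᶜ ⊆ ⋃ n : ℕ, (Set.Icc (c - 1 / ((n:ℝ) + 1)) (d + 1 / ((n:ℝ) + 1)))ᶜ := by
    intro x hx
    rw [Set.mem_iUnion]
    by_contra hcon
    push Not at hcon
    simp only [Set.mem_compl_iff, not_not] at hcon
    apply hx
    constructor
    · refine le_of_forall_pos_le_add (fun ε hε => ?_)
      obtain ⟨n, hn⟩ := exists_nat_one_div_lt hε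
      have := (hcon n).1
      linarith
    · refine le_of_forall_pos_le_add (fun ε hε => ?_)
      obtain ⟨n, hn⟩ := exists_nat_one_div_lt hε
      have := (hcon n).2
      linarith
  exact measure_mono_null hU (measure_iUnion_null (fun n => hM _ (by positivity)))

lemma exists_gap {R a b c d : ℝ}
    (hdisj : Disjoint ((fun x : ℝ => x / R + a) '' Set.Icc c d)
        ((fun x : ℝ => x / R + b) '' Set.Icc c d)) :
    ∃ δ : ℝ, 0 < δ ∧ ∀ x ∈ Set.Icc c d, ∀ y ∈ Set.Icc c d,
      δ ≤ dist (x / R + a) (y / R + b) := by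
  have h1 : IsCompact ((fun x : ℝ => x / R + a) '' Set.Icc c d) :=
    isCompact_Icc.image (by fun_prop)
  have h2 : IsCompact ((fun x : ℝ => x / R + b) '' Set.Icc c d) :=
    isCompact_Icc.image (by fun_prop)
  obtain ⟨δ, hδ, h⟩ := Metric.exists_pos_forall_lt_edist h1 h2.isClosed hdisj
  refine ⟨δ, by exact_mod_cast hδ, fun x hx y hy => ?_⟩
  have := h _ ⟨x, hx, rfl⟩ _ ⟨y, hy, rfl⟩
  rw [edist_nndist] at this
  have h3 : δ < nndist (x / R + a) (y / R + b) := by exact_mod_cast this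
  rw [← coe_nndist]
  exact_mod_cast h3.le

/-- measure of a small ball centered in a first-level piece -/
lemma ball_measure {R a b c d p q δ : ℝ} {μ : Measure ℝ} (hR : 0 < R)
    (hss : μ = ENNReal.ofReal p • μ.map (fun x : ℝ => x / R + a) +
        ENNReal.ofReal q • μ.map (fun x : ℝ => x / R + b))
    (h0 : μ (Set.Icc c d)ᶜ = 0)
    (hδ : ∀ x ∈ Set.Icc c d, ∀ y ∈ Set.Icc c d, δ ≤ dist (x / R + a) (y / R + b))
    {y r : ℝ} (hy : y ∈ Set.Icc c d) (hr : r ≤ δ) :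
    μ (Metric.ball (y / R + a) r) = ENNReal.ofReal p * μ (Metric.ball y (R * r)) := by
  rw [ss_apply hss Metric.isOpen_ball.measurableSet, affine_ball_preimage hR]
  have : μ ((fun x : ℝ => x / R + b) ⁻¹' Metric.ball (y / R + a) r) = 0 := by
    refine measure_mono_null ?_ h0
    intro z hz hz'
    have h1 := hδ y hy z hz'
    rw [Set.mem_preimage, Metric.mem_ball, dist_comm] at hz
    linarith
  rw [this, mul_zero, add_zero]

lemma inSupp_iff {R a b c d p q δ : ℝ} {μ : Measure ℝ} (hR : 0 < R) (hp : 0 < p) (hδ0 : 0 < δ)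
    (hss : μ = ENNReal.ofReal p • μ.map (fun x : ℝ => x / R + a) +
        ENNReal.ofReal q • μ.map (fun x : ℝ => x / R + b))
    (h0 : μ (Set.Icc c d)ᶜ = 0)
    (hδ : ∀ x ∈ Set.Icc c d, ∀ y ∈ Set.Icc c d, δ ≤ dist (x / R + a) (y / R + b))
    {y : ℝ} (hy : y ∈ Set.Icc c d) : InSupp μ (y / R + a) ↔ InSupp μ y := by
  constructor
  · intro h ε hε
    have h1 : 0 < min δ (ε / R) := lt_min hδ0 (by positivity)
    have h2 := h _ h1
    rw [ball_measure hR hss h0 hδ hy (min_le_left _ _)] at h2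
    have h3 : 0 < μ (Metric.ball y (R * min δ (ε / R))) := by
      rw [pos_iff_ne_zero] at h2 ⊢
      exact right_ne_zero_of_mul h2
    refine h3.trans_le (measure_mono (Metric.ball_subset_ball ?_))
    calc R * min δ (ε / R) ≤ R * (ε / R) := by gcongr; exact min_le_right _ _
      _ = ε := by field_simp
  · intro h ε hε
    have h1 : 0 < min δ ε := lt_min hδ0 hε
    refine lt_of_lt_of_le ?_ (measure_mono (Metric.ball_subset_ball (min_le_right δ ε)))
    rw [ball_measure hR hss h0 hδ hy (min_le_left _ _)]
    have := h (R * min δ ε) (by positivity)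
    exact ENNReal.mul_pos (ENNReal.ofReal_pos.2 hp).ne' this.ne'

lemma dist_affine {R a x y : ℝ} (hR : 0 < R) :
    dist (x / R + a) (y / R + a) = dist x y / R := by
  simp only [Real.dist_eq]
  have : x / R + a - (y / R + a) = (x - y) / R := by ring
  rw [this, abs_div, abs_of_pos hR]

lemma pack_iff {μ : Measure ℝ} {r : ℝ} (hr : 0 < r) {s : Finset ℝ} :
    IsPack μ r s ↔ (∀ x ∈ s, InSupp μ x) ∧ ∀ x ∈ s, ∀ y ∈ s, x ≠ y → r + r ≤ dist x y := by
  unfold IsPack InSupp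
  refine and_congr Iff.rfl ?_
  constructor
  · intro h x hx y hy hxy
    exact (disjoint_ball_ball_iff hr hr).1 (h hx hy hxy)
  · intro h x hx y hy hxy
    exact (disjoint_ball_ball_iff hr hr).2 (h x hx y hy hxy)

lemma affine_inj {R a : ℝ} (hR : 0 < R) : Function.Injective (fun x : ℝ => x / R + a) := by
  intro x y h
  have : x / R = y / R := by simpa using h
  field_simp at this
  exact this

/-- sum over the image of a set of points -/
lemma sum_image {R a b c d p q δ r t : ℝ} {μ : Measure ℝ} (hR : 0 < R) (hp : 0 < p)
    (hss : μ = ENNReal.ofReal p • μ.map (fun x : ℝ => x / R + a) +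
        ENNReal.ofReal q • μ.map (fun x : ℝ => x / R + b))
    (h0 : μ (Set.Icc c d)ᶜ = 0)
    (hδ : ∀ x ∈ Set.Icc c d, ∀ y ∈ Set.Icc c d, δ ≤ dist (x / R + a) (y / R + b))
    (hr : r ≤ δ) (s : Finset ℝ) (hs : ∀ x ∈ s, x ∈ Set.Icc c d) :
    ∑ x ∈ s.image (fun x : ℝ => x / R + a), (μ (Metric.ball x r)).toReal ^ t =
      p ^ t * ∑ x ∈ s, (μ (Metric.ball x (R * r))).toReal ^ t := by
  rw [Finset.sum_image (fun x _ y _ h => affine_inj hR h), Finset.mul_sum]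
  refine Finset.sum_congr rfl (fun x hx => ?_)
  rw [ball_measure hR hss h0 hδ (hs x hx) hr, ENNReal.toReal_mul, ENNReal.toReal_ofReal hp.le,
    Real.mul_rpow hp.le ENNReal.toReal_nonneg]

lemma recursion {R a b c d p q δ r t : ℝ} {μ : Measure ℝ} [IsProbabilityMeasure μ] (hR : 0 < R)
    (hp : 0 < p) (hq : 0 < q)
    (hss : μ = ENNReal.ofReal p • μ.map (fun x : ℝ => x / R + a) +
        ENNReal.ofReal q • μ.map (fun x : ℝ => x / R + b))
    (h0 : μ (Set.Icc c d)ᶜ = 0) (hδ0 : 0 < δ)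
    (hδ : ∀ x ∈ Set.Icc c d, ∀ y ∈ Set.Icc c d, δ ≤ dist (x / R + a) (y / R + b))
    (hr0 : 0 < r) (hr : r ≤ δ / 2) :
    packingSum μ t r = (p ^ t + q ^ t) * packingSum μ t (R * r) := by
  have hbound : ∀ r, 0 < r → ∃ B : ℝ, 0 ≤ B ∧ ∀ s, IsPack μ r s →
      ∑ x ∈ s, (μ (Metric.ball x r)).toReal ^ t ≤ B := by
    intro r hr
    obtain ⟨m, hm, hmρ⟩ := exists_lower isCompact_Icc h0 hr
    refine ⟨(1 + m ^ t) / m, by positivity, fun s hs => pack_bound hm hmρ le_rfl s hs⟩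
  have hRr : 0 < R * r := by positivity
  have hrδ : r ≤ δ := by linarith
  have hptp : 0 < p ^ t := Real.rpow_pos_of_pos hp t
  have hqtp : 0 < q ^ t := Real.rpow_pos_of_pos hq t
  have hss' : μ = ENNReal.ofReal q • μ.map (fun x : ℝ => x / R + b) +
        ENNReal.ofReal p • μ.map (fun x : ℝ => x / R + a) := by
    rw [add_comm]; exact hss
  have hδ' : ∀ x ∈ Set.Icc c d, ∀ y ∈ Set.Icc c d, δ ≤ dist (x / R + b) (y / R + a) := by
    intro x hx y hy
    rw [dist_comm]; exact hδ y hy x hx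
  obtain ⟨B, hB, hBs⟩ := hbound r hr0
  obtain ⟨B', hB', hBs'⟩ := hbound (R * r) hRr
  have hsI : ∀ x, InSupp μ x → x ∈ Set.Icc c d := fun x hx => inSupp_mem isClosed_Icc h0 hx
  have hnn : 0 ≤ packingSum μ t (R * r) := by
    have := le_packingSum hB' hBs' (s := ∅) ((pack_iff hRr).2 (by simp))
    simpa using this
  apply le_antisymm
  · refine packingSum_le (by positivity) (fun s hs => ?_)
    rw [pack_iff hr0] at hs
    -- support in the union of the two pieces
    have hU : ∀ x, InSupp μ x → x ∈ ((fun x : ℝ => x / R + a) '' Set.Icc c d) ∪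
        ((fun x : ℝ => x / R + b) '' Set.Icc c d) := by
      intro x hx
      have hcl : IsClosed (((fun x : ℝ => x / R + a) '' Set.Icc c d) ∪
        ((fun x : ℝ => x / R + b) '' Set.Icc c d)) :=
        (isCompact_Icc.image (by fun_prop)).isClosed.union
          (isCompact_Icc.image (by fun_prop)).isClosed
      refine inSupp_mem hcl ?_ hx
      rw [ss_apply hss hcl.measurableSet.compl]
      have e1 : μ ((fun x : ℝ => x / R + a) ⁻¹' (((fun x : ℝ => x / R + a) '' Set.Icc c d) ∪
        ((fun x : ℝ => x / R + b) '' Set.Icc c d))ᶜ) = 0 :=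
        measure_mono_null (fun z hz hz' => hz (Or.inl ⟨z, hz', rfl⟩)) h0
      have e2 : μ ((fun x : ℝ => x / R + b) ⁻¹' (((fun x : ℝ => x / R + a) '' Set.Icc c d) ∪
        ((fun x : ℝ => x / R + b) '' Set.Icc c d))ᶜ) = 0 :=
        measure_mono_null (fun z hz hz' => hz (Or.inr ⟨z, hz', rfl⟩)) h0
      rw [e1, e2]; simp
    -- pull back the part of the packing in one piece
    have pull : ∀ (e : ℝ) (s' : Finset ℝ), s' ⊆ s →
        (∀ x ∈ s', x ∈ (fun x : ℝ => x / R + e) '' Set.Icc c d) →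
        (∀ y ∈ Set.Icc c d, InSupp μ (y / R + e) → InSupp μ y) →
        ∃ u : Finset ℝ, IsPack μ (R * r) u ∧ s' = u.image (fun x : ℝ => x / R + e) := by
      intro e s' hsub hpiece hsupp
      have hinv : ∀ x : ℝ, R * (x - e) / R + e = x := by intro x; field_simp; ring
      refine ⟨s'.image (fun x => R * (x - e)), ?_, ?_⟩
      · rw [pack_iff hRr]
        constructor
        · intro y hy
          obtain ⟨x, hx, rfl⟩ := Finset.mem_image.1 hy
          obtain ⟨z, hz, rfl⟩ := hpiece x hx
          have hzz : R * (z / R + e - e) = z := by field_simp; ring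
          simp only [hzz]
          exact hsupp z hz (hs.1 _ (hsub hx))
        · intro y hy y' hy' hne
          obtain ⟨x, hx, rfl⟩ := Finset.mem_image.1 hy
          obtain ⟨x', hx', rfl⟩ := Finset.mem_image.1 hy'
          have hxx : x ≠ x' := by rintro rfl; exact hne rfl
          have h1 := hs.2 x (hsub hx) x' (hsub hx') hxx
          have h2 := dist_affine (R := R) (a := e) (x := R * (x - e)) (y := R * (x' - e)) hR
          rw [hinv, hinv] at h2
          rw [h2, le_div_iff₀ hR] at h1
          linarith
      · rw [Finset.image_image]
        ext x
        simp [Function.comp_def, hinv]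
    classical
    obtain ⟨u, hu, hu'⟩ := pull a (s.filter (fun x => x ∈ (fun x : ℝ => x / R + a) '' Set.Icc c d))
      (Finset.filter_subset _ _) (fun x hx => (Finset.mem_filter.1 hx).2)
      (fun y hy => (inSupp_iff hR hp hδ0 hss h0 hδ hy).1)
    obtain ⟨v, hv, hv'⟩ := pull b
      (s.filter (fun x => ¬ x ∈ (fun x : ℝ => x / R + a) '' Set.Icc c d))
      (Finset.filter_subset _ _) (fun x hx => by
        have h1 := Finset.mem_filter.1 hx
        exact (hU x (hs.1 x h1.1)).resolve_left h1.2)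
      (fun y hy => (inSupp_iff hR hq hδ0 hss' h0 hδ' hy).1)
    rw [← Finset.sum_filter_add_sum_filter_not s
      (fun x => x ∈ (fun x : ℝ => x / R + a) '' Set.Icc c d), hu', hv',
      sum_image hR hp hss h0 hδ hrδ u (fun x hx => hsI x (hu.1 x hx)),
      sum_image hR hq hss' h0 hδ' hrδ v (fun x hx => hsI x (hv.1 x hx)), add_mul]
    have h1 := le_packingSum hB' hBs' hu
    have h2 := le_packingSum hB' hBs' hv
    gcongr
  · have key : ∀ u v, IsPack μ (R * r) u → IsPack μ (R * r) v →
        p ^ t * ∑ x ∈ u, (μ (Metric.ball x (R * r))).toReal ^ t +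
        q ^ t * ∑ x ∈ v, (μ (Metric.ball x (R * r))).toReal ^ t ≤ packingSum μ t r := by
      intro u v hu hv
      have hu2 := (pack_iff hRr).1 hu
      have hv2 := (pack_iff hRr).1 hv
      have huI : ∀ x ∈ u, x ∈ Set.Icc c d := fun x hx => hsI x (hu2.1 x hx)
      have hvI : ∀ x ∈ v, x ∈ Set.Icc c d := fun x hx => hsI x (hv2.1 x hx)
      rw [← sum_image hR hp hss h0 hδ hrδ u huI, ← sum_image hR hq hss' h0 hδ' hrδ v hvI]
      rw [← Finset.sum_union]
      · refine le_packingSum hB hBs ?_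
        rw [pack_iff hr0]
        constructor
        · intro x hx
          rcases Finset.mem_union.1 hx with hx | hx
          · obtain ⟨y, hy, rfl⟩ := Finset.mem_image.1 hx
            exact (inSupp_iff hR hp hδ0 hss h0 hδ (huI y hy)).2 (hu2.1 y hy)
          · obtain ⟨y, hy, rfl⟩ := Finset.mem_image.1 hx
            exact (inSupp_iff hR hq hδ0 hss' h0 hδ' (hvI y hy)).2 (hv2.1 y hy)
        · intro x hx x' hx' hne
          rcases Finset.mem_union.1 hx with hx | hx <;> rcases Finset.mem_union.1 hx' with hx' | hx'
            <;> obtain ⟨y, hy, rfl⟩ := Finset.mem_image.1 hx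
            <;> obtain ⟨y', hy', rfl⟩ := Finset.mem_image.1 hx'
          · have hyy : y ≠ y' := by rintro rfl; exact hne rfl
            rw [dist_affine hR, le_div_iff₀ hR]
            linarith [hu2.2 y hy y' hy' hyy]
          · linarith [hδ y (huI y hy) y' (hvI y' hy')]
          · linarith [hδ' y (hvI y hy) y' (huI y' hy')]
          · have hyy : y ≠ y' := by rintro rfl; exact hne rfl
            rw [dist_affine hR, le_div_iff₀ hR]
            linarith [hv2.2 y hy y' hy' hyy]
      · rw [Finset.disjoint_left]
        intro x hx hx'
        obtain ⟨y, hy, rfl⟩ := Finset.mem_image.1 hx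
        obtain ⟨y', hy', h⟩ := Finset.mem_image.1 hx'
        have h1 := hδ y (huI y hy) y' (hvI y' hy')
        rw [h, dist_self] at h1
        linarith
    have hE : IsPack μ (R * r) ∅ := (pack_iff hRr).2 (by simp)
    have key2 : ∀ v, IsPack μ (R * r) v → p ^ t * packingSum μ t (R * r) +
        q ^ t * ∑ x ∈ v, (μ (Metric.ball x (R * r))).toReal ^ t ≤ packingSum μ t r := by
      intro v hv
      have : packingSum μ t (R * r) ≤ (packingSum μ t r -
          q ^ t * ∑ x ∈ v, (μ (Metric.ball x (R * r))).toReal ^ t) / p ^ t := by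
        refine packingSum_le ?_ (fun u hu => ?_)
        · have := key ∅ v hE hv
          rw [Finset.sum_empty, mul_zero, zero_add] at this
          exact div_nonneg (by linarith) hptp.le
        · rw [le_div_iff₀ hptp]
          linarith [key u v hu hv]
      rw [le_div_iff₀ hptp] at this
      linarith
    have : packingSum μ t (R * r) ≤
        (packingSum μ t r - p ^ t * packingSum μ t (R * r)) / q ^ t := by
      refine packingSum_le ?_ (fun v hv => ?_)
      · have := key2 ∅ hE
        rw [Finset.sum_empty, mul_zero, add_zero] at this
        exact div_nonneg (by linarith) hqtp.le
      · rw [le_div_iff₀ hqtp]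
        linarith [key2 v hv]
    rw [le_div_iff₀ hqtp] at this
    linarith

lemma packing_bounds {c d : ℝ} {μ : Measure ℝ} [IsProbabilityMeasure μ]
    (h0 : μ (Set.Icc c d)ᶜ = 0) (t : ℝ) {ρ : ℝ} (hρ : 0 < ρ) :
    ∃ L U : ℝ, 0 < L ∧ ∀ r, ρ ≤ r → L ≤ packingSum μ t r ∧ packingSum μ t r ≤ U := by
  obtain ⟨m, hm, hmρ⟩ := exists_lower isCompact_Icc h0 hρ
  obtain ⟨x, hx⟩ := exists_inSupp isCompact_Icc h0
  have hmt : 0 < m ^ t := Real.rpow_pos_of_pos hm t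
  have hU : 0 ≤ (1 + m ^ t) / m := by positivity
  refine ⟨min 1 (m ^ t), (1 + m ^ t) / m, lt_min one_pos hmt, fun r hr => ⟨?_, ?_⟩⟩
  · have hs : IsPack μ r {x} := by
      refine ⟨?_, by simp⟩
      intro y hy
      rw [Finset.mem_singleton] at hy
      subst hy
      exact hx
    have h1 := le_packingSum (t := t) hU (fun s hs => pack_bound hm hmρ hr s hs) hs
    rw [Finset.sum_singleton] at h1
    refine le_trans ?_ h1
    refine rpow_lower hm ((hmρ x hx).trans ?_) (toReal_le_one' μ _)
    exact ENNReal.toReal_mono (measure_ne_top _ _) (measure_mono (Metric.ball_subset_ball hr))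
  · exact packingSum_le hU (fun s hs => pack_bound hm hmρ hr s hs)

/-- for the self-similar measure of a two-map IFS with ratio `1/R`
satisfying the strong separation condition and probabilities `p, q`, the
`L^q`-spectrum is `τ_μ(t) = −log(pᵗ + qᵗ)/log R` for all `t`, and in particular
`τ_μ(0) = −log 2/log R`. -/
theorem stmt_13 (R a b c d p q : ℝ) (hR : 2 < R) (hcd : c < d)
    (hmapsa : Set.MapsTo (fun x : ℝ => x / R + a) (Set.Icc c d) (Set.Icc c d))
    (hmapsb : Set.MapsTo (fun x : ℝ => x / R + b) (Set.Icc c d) (Set.Icc c d))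
    (hdisj : Disjoint ((fun x : ℝ => x / R + a) '' Set.Icc c d)
        ((fun x : ℝ => x / R + b) '' Set.Icc c d))
    (hp : 0 < p) (hq : 0 < q) (hpq : p + q = 1)
    (μ : MeasureTheory.Measure ℝ) [IsProbabilityMeasure μ]
    (hss : μ = ENNReal.ofReal p • μ.map (fun x : ℝ => x / R + a) +
        ENNReal.ofReal q • μ.map (fun x : ℝ => x / R + b)) :
    (∀ t : ℝ, lqSpectrum μ t = -Real.log (p ^ t + q ^ t) / Real.log R) ∧
      lqSpectrum μ 0 = -Real.log 2 / Real.log R := by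
  have hR0 : 0 < R := by linarith
  have h0 := compl_null (by linarith) hcd hmapsa hmapsb hp hq hpq hss
  obtain ⟨δ, hδ0, hδ⟩ := exists_gap hdisj
  have main : ∀ t : ℝ, lqSpectrum μ t = -Real.log (p ^ t + q ^ t) / Real.log R := by
    intro t
    have hA : 0 < p ^ t + q ^ t :=
      add_pos (Real.rpow_pos_of_pos hp t) (Real.rpow_pos_of_pos hq t)
    obtain ⟨L, U, hL, hb⟩ := packing_bounds h0 t (half_pos hδ0)
    refine (limit_of_recursion (by linarith) hA (half_pos hδ0) hL hb ?_ ?_).liminf_eq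
    · intro r hr
      obtain ⟨L', U', hL', hb'⟩ := packing_bounds h0 t hr
      exact hL'.trans_le (hb' r le_rfl).1
    · intro r hr hrδ
      exact recursion hR0 hp hq hss h0 hδ0 hδ hr hrδ
  refine ⟨main, ?_⟩
  rw [main 0, Real.rpow_zero, Real.rpow_zero]
  norm_num
end
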